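/- Let r ≥ 2, m ≥ 1, k ≥ 0, and let m_1, m_2 ≥ 0 be integers with (k−1)r + 1 ≤ m_1, m_2 ≤ kr + 1. Then the multi-arrangement (A, μ) in ℂ² with defining polynomial Q(A,μ) = x^{m_1} y^{m_2} (x^r − y^r)^{2m} is free with exponents exp(A,μ) = { rm + m_1, rm + m_2 }. -/

import Mathlib

open MvPolynomial

noncomputable section

abbrev PolyS (ℓ : ℕ) := MvPolynomial (Fin ℓ) ℂ

/-- Membership in `D(A, μ)` for the multi-arrangement in `ℂ^ℓ` consisting of the
coordinate hyperplanes `ker x_i` with multiplicity `mult0 i` and the hyperplanes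
`ker (x_i - ζ x_j)` (for `i < j` and `ζ` an `r`-th root of unity) with
multiplicity `multH`.  (A multiplicity `0` means the hyperplane is absent.) -/
def InDeriv {ℓ : ℕ} (r : ℕ) (mult0 : Fin ℓ → ℕ) (multH : ℕ)
    (θ : Derivation ℂ (PolyS ℓ) (PolyS ℓ)) : Prop :=
  (∀ i, θ (X i) ∈ Ideal.span {(X i : PolyS ℓ) ^ mult0 i}) ∧
  ∀ i j : Fin ℓ, i < j → ∀ ζ : ℂ, ζ ^ r = 1 →
    θ (X i - C ζ * X j) ∈ Ideal.span {(X i - C ζ * X j : PolyS ℓ) ^ multH}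

/-- `θ` is homogeneous of polynomial degree `p`. -/
def IsHomogDeriv {ℓ : ℕ} (θ : Derivation ℂ (PolyS ℓ) (PolyS ℓ)) (p : ℕ) : Prop :=
  ∀ i, (θ (X i)).IsHomogeneous p

/-- The multi-arrangement with derivation-module membership predicate `P` is free with
exponents `e 0, …, e (ℓ-1)`: there is a basis of the module of derivations consisting
of `ℓ` homogeneous derivations of polynomial degrees `e 0, …, e (ℓ-1)`. -/
def IsFreeWithExponents {ℓ : ℕ} (P : Derivation ℂ (PolyS ℓ) (PolyS ℓ) → Prop)
    (e : Fin ℓ → ℕ) : Prop :=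
  ∃ θ : Fin ℓ → Derivation ℂ (PolyS ℓ) (PolyS ℓ),
    (∀ i, P (θ i)) ∧
    LinearIndependent (PolyS ℓ) θ ∧
    (∀ η, P η → η ∈ Submodule.span (PolyS ℓ) (Set.range θ)) ∧
    (∀ i, IsHomogDeriv (θ i) (e i))

/-- Variant of `IsFreeWithExponents` with the exponents given as integers. -/
def IsFreeWithExponentsZ {ℓ : ℕ} (P : Derivation ℂ (PolyS ℓ) (PolyS ℓ) → Prop)
    (e : Fin ℓ → ℤ) : Prop :=
  ∃ θ : Fin ℓ → Derivation ℂ (PolyS ℓ) (PolyS ℓ),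
    (∀ i, P (θ i)) ∧
    LinearIndependent (PolyS ℓ) θ ∧
    (∀ η, P η → η ∈ Submodule.span (PolyS ℓ) (Set.range θ)) ∧
    (∀ i, ∃ p : ℕ, (p : ℤ) = e i ∧ IsHomogDeriv (θ i) p)

/-- The binary form `∑ i ≤ n, a i * P ^ (r * i) * Q ^ (r * (n - i))`, homogeneous of degree `n`
in `P ^ r` and `Q ^ r`. -/
def powForm (r n : ℕ) (a : ℕ → ℂ) (P Q : PolyS 2) : PolyS 2 :=
  ∑ i ∈ Finset.range (n + 1), C (a i) * P ^ (r * i) * Q ^ (r * (n - i))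

lemma isHomogeneous_powForm (r n : ℕ) (a : ℕ → ℂ) {P Q : PolyS 2}
    (hP : P.IsHomogeneous 1) (hQ : Q.IsHomogeneous 1) :
    (powForm r n a P Q).IsHomogeneous (r * n) := by
  refine IsHomogeneous.sum _ _ _ fun i hi => ?_
  have hin : i ≤ n := by simpa [Nat.lt_succ_iff] using hi
  have h := ((isHomogeneous_C (Fin 2) (a i)).mul (hP.pow (r * i))).mul (hQ.pow (r * (n - i)))
  convert h using 1
  rw [zero_add, one_mul, one_mul, ← mul_add, Nat.add_sub_cancel' hin]

lemma powForm_C_mul_left (r n : ℕ) (a : ℕ → ℂ) {ω : ℂ} (hω : ω ^ r = 1) (P Q : PolyS 2) :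
    powForm r n a (C ω * P) Q = powForm r n a P Q := by
  refine Finset.sum_congr rfl fun i _ => ?_
  rw [mul_pow, pow_mul (C ω), ← C_pow, hω, C_1, one_pow, one_mul]

lemma eval_powForm_zero_right {r : ℕ} (hr : r ≠ 0) (n : ℕ) (a : ℕ → ℂ) (P Q : PolyS 2)
    (v : Fin 2 → ℂ) (hP : eval v P = 1) (hQ : eval v Q = 0) :
    eval v (powForm r n a P Q) = a n := by
  rw [powForm, map_sum, Finset.sum_eq_single_of_mem n (by simp)]
  · simp [hP]
  · intro i hi hne
    have : r * (n - i) ≠ 0 := by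
      have : i < n + 1 := by simpa using hi
      exact mul_ne_zero hr (by omega)
    simp [hQ, this]

lemma eval_powForm_zero_left {r : ℕ} (hr : r ≠ 0) (n : ℕ) (a : ℕ → ℂ) (P Q : PolyS 2)
    (v : Fin 2 → ℂ) (hP : eval v P = 0) (hQ : eval v Q = 1) :
    eval v (powForm r n a P Q) = a 0 := by
  rw [powForm, map_sum, Finset.sum_eq_single_of_mem 0 (by simp)]
  · simp [hQ]
  · intro i _ hne
    simp [hP, hr, hne]

/-- For every finite set `s` of exponents there is a binary form supported exactly on `s` which
vanishes to order `#s - 1` along the diagonal. -/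
lemma exists_sparse_form (s : Finset ℕ) :
    ∃ c : ℕ → ℂ, (∀ e ∈ s, c e ≠ 0) ∧ ∀ N, (∀ e ∈ s, e ≤ N) → ∀ P Q : PolyS 2,
      (P - Q) ^ (s.card - 1) ∣ ∑ e ∈ s, C (c e) * P ^ e * Q ^ (N - e) := by
  have hinj : Set.InjOn (fun e : ℕ => (e : ℂ)) (s : Set ℕ) := Nat.cast_injective.injOn
  refine ⟨fun e => (∏ j ∈ s.erase e, ((e : ℂ) - j))⁻¹, fun e _ => ?_, fun N hN P Q => ?_⟩
  · refine inv_ne_zero (Finset.prod_ne_zero_iff.mpr fun j hj => sub_ne_zero.mpr ?_)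
    exact_mod_cast (Finset.ne_of_mem_erase hj).symm
  set c : ℕ → ℂ := fun e => (∏ j ∈ s.erase e, ((e : ℂ) - j))⁻¹ with hc
  have hvan : ∀ j < s.card - 1, ∑ e ∈ s, c e * (e.choose j : ℂ) = 0 := by
    intro j hj
    have hdeg : (descPochhammer ℂ j).natDegree = j := descPochhammer_natDegree ℂ j
    have hlag := Lagrange.coeff_eq_sum hinj (P := descPochhammer ℂ j)
      ((Polynomial.degree_le_natDegree).trans_lt (by rw [hdeg]; exact_mod_cast (by omega)))
    rw [Polynomial.coeff_eq_zero_of_natDegree_lt (by rw [hdeg]; exact hj)] at hlag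
    have hfac : (j.factorial : ℂ) ≠ 0 := by exact_mod_cast j.factorial_ne_zero
    refine (mul_eq_zero.mp ?_).resolve_left hfac
    rw [Finset.mul_sum, hlag]
    refine Finset.sum_congr rfl fun e _ => ?_
    rw [descPochhammer_eval_eq_descFactorial, Nat.descFactorial_eq_factorial_mul_choose, hc]
    push_cast
    ring
  have hexp : ∀ e ∈ s, C (c e) * P ^ e * Q ^ (N - e) =
      ∑ j ∈ Finset.range (N + 1), C (c e * (e.choose j : ℂ)) * ((P - Q) ^ j * Q ^ (N - j)) := by
    intro e he
    have heN := hN e he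
    have hsub : Finset.range (e + 1) ⊆ Finset.range (N + 1) :=
      Finset.range_subset_range.mpr (by omega)
    rw [← Finset.sum_subset hsub]
    · conv_lhs => rw [show P = (P - Q) + Q by ring, add_pow]
      rw [Finset.mul_sum, Finset.sum_mul]
      refine Finset.sum_congr rfl fun j hj => ?_
      have hje : j < e + 1 := by simpa using hj
      rw [show N - j = (e - j) + (N - e) by omega, pow_add]
      simp only [map_mul, map_natCast]
      ring
    · intro j _ hj
      rw [Nat.choose_eq_zero_of_lt (by simpa using hj)]
      simp
  rw [Finset.sum_congr rfl hexp, Finset.sum_comm]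
  refine Finset.dvd_sum fun j _ => ?_
  rw [← Finset.sum_mul, ← map_sum]
  rcases lt_or_ge j (s.card - 1) with hj | hj
  · rw [hvan j hj]
    simp
  · exact ((pow_dvd_pow _ hj).mul_right _).mul_left _

/-- The pair of forms `F`, `G` from which both basis derivations are built. -/
lemma exists_powForm_pair {r : ℕ} (hr : 2 ≤ r) (n k : ℕ) :
    ∃ a b : ℕ → ℂ, b 0 ≠ 0 ∧ b (n + 1) ≠ 0 ∧
      ∀ M s : ℕ, s + (k * r + 1) = M + r → ∀ P Q : PolyS 2,
        (P - Q) ^ (2 * (n + 1)) ∣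
          P ^ (k * r + 1) * Q ^ s * powForm r n a P Q - Q ^ M * powForm r (n + 1) b P Q := by
  have hinj₁ : Function.Injective fun i : ℕ => k * r + 1 + r * i := fun i j h => by
    have h' : r * i = r * j := by simpa using h
    exact Nat.eq_of_mul_eq_mul_left (by omega) h'
  have hinj₂ : Function.Injective fun i : ℕ => r * i := fun i j h =>
    Nat.eq_of_mul_eq_mul_left (by omega) h
  set s₁ := (Finset.range (n + 1)).image fun i => k * r + 1 + r * i with hs₁
  set s₂ := (Finset.range (n + 1 + 1)).image fun i => r * i with hs₂
  have hdisj : Disjoint s₁ s₂ := by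
    rw [Finset.disjoint_left]
    intro e h₁ h₂
    obtain ⟨i, -, rfl⟩ := Finset.mem_image.mp h₁
    obtain ⟨j, -, hj⟩ := Finset.mem_image.mp h₂
    have hdvd : r ∣ 1 := by
      have h : r ∣ (k * r + r * i) + 1 := ⟨j, by rw [hj]; ring⟩
      exact (Nat.dvd_add_right ⟨k + i, by ring⟩).mp h
    have := Nat.le_of_dvd one_pos hdvd
    omega
  have hcard : (s₁ ∪ s₂).card - 1 = 2 * (n + 1) := by
    rw [Finset.card_union_of_disjoint hdisj, Finset.card_image_of_injective _ hinj₁,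
      Finset.card_image_of_injective _ hinj₂, Finset.card_range, Finset.card_range]
    omega
  obtain ⟨c, hc, hdvd⟩ := exists_sparse_form (s₁ ∪ s₂)
  have hmem : ∀ i ≤ n + 1, r * i ∈ s₁ ∪ s₂ := fun i hi =>
    Finset.mem_union_right _ (Finset.mem_image_of_mem _ (by simp; omega))
  refine ⟨fun i => c (k * r + 1 + r * i), fun i => -c (r * i),
    neg_ne_zero.mpr (hc _ (hmem 0 (by omega))), neg_ne_zero.mpr (hc _ (hmem (n + 1) le_rfl)), fun M s hM P Q => ?_⟩
  have hle₁ : ∀ i < n + 1, M + r * (n + 1) - (k * r + 1 + r * i) = s + r * (n - i) ∧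
      k * r + 1 + r * i ≤ M + r * (n + 1) := by
    intro i hi
    obtain ⟨d, rfl⟩ := Nat.exists_eq_add_of_le (Nat.lt_succ_iff.mp hi)
    rw [Nat.add_sub_cancel_left, mul_add, mul_add, mul_one]
    omega
  have hle₂ : ∀ i < n + 1 + 1, M + r * (n + 1) - r * i = M + r * (n + 1 - i) ∧
      r * i ≤ M + r * (n + 1) := by
    intro i hi
    obtain ⟨d, hd⟩ := Nat.exists_eq_add_of_le (Nat.lt_succ_iff.mp hi)
    rw [hd, Nat.add_sub_cancel_left, mul_add]
    omega
  have hN : ∀ e ∈ s₁ ∪ s₂, e ≤ M + r * (n + 1) := by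
    intro e he
    rcases Finset.mem_union.mp he with h | h <;> obtain ⟨i, hi, rfl⟩ := Finset.mem_image.mp h
    · exact (hle₁ i (by simpa using hi)).2
    · exact (hle₂ i (by simpa using hi)).2
  have h := hdvd _ hN P Q
  rw [hcard, Finset.sum_union hdisj, Finset.sum_image hinj₁.injOn,
    Finset.sum_image hinj₂.injOn] at h
  convert h using 1
  rw [sub_eq_add_neg, powForm, powForm, Finset.mul_sum, Finset.mul_sum, ← Finset.sum_neg_distrib]
  congr 1
  · refine Finset.sum_congr rfl fun i hi => ?_
    rw [(hle₁ i (by simpa using hi)).1]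
    ring
  · refine Finset.sum_congr rfl fun i hi => ?_
    rw [(hle₂ i (by simpa using hi)).1, C_neg]
    ring

lemma isRelPrime_X_zero_X_one : IsRelPrime (X 0 : PolyS 2) (X 1) := by
  refine ((MvPolynomial.X_prime (R := ℂ) (i := (0 : Fin 2))).irreducible.isRelPrime_iff_not_dvd).mpr ?_
  intro h
  have h' := map_dvd (eval ![(0 : ℂ), 1]) h
  simp at h'

lemma isRelPrime_X_sub_C_mul_X {ζ ξ : ℂ} (h : ζ ≠ ξ) :
    IsRelPrime (X 0 - C ζ * X 1 : PolyS 2) (X 0 - C ξ * X 1) := by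
  intro d h₁ h₂
  have hu : (C (ξ - ζ)⁻¹ * C (ξ - ζ) : PolyS 2) = 1 := by
    rw [← C_mul, inv_mul_cancel₀ (sub_ne_zero.mpr h.symm), C_1]
  have hX1 : d ∣ X 1 := by
    have h₃ := (dvd_sub h₁ h₂).mul_left (C (ξ - ζ)⁻¹)
    convert h₃ using 1
    rw [C_sub] at hu
    linear_combination -(X 1) * hu
  refine isRelPrime_X_zero_X_one ?_ hX1
  convert dvd_add h₁ (hX1.mul_left (C ζ)) using 1
  ring

lemma isRelPrime_X_one_sub (ζ : ℂ) : IsRelPrime (X 1 : PolyS 2) (X 0 - C ζ * X 1) := by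
  intro d h₁ h₂
  refine isRelPrime_X_zero_X_one ?_ h₁
  convert dvd_add h₂ (h₁.mul_left (C ζ)) using 1
  ring

/-- The defining polynomial of the multi-arrangement. -/
def definingPoly (r m₁ m₂ n : ℕ) : PolyS 2 :=
  X 0 ^ m₁ * X 1 ^ m₂ * ∏ ζ ∈ Polynomial.nthRootsFinset r (1 : ℂ), (X 0 - C ζ * X 1) ^ n

lemma isHomogeneous_X_sub (ζ : ℂ) : (X 0 - C ζ * X 1 : PolyS 2).IsHomogeneous 1 :=
  (isHomogeneous_X ℂ 0).sub ((isHomogeneous_X ℂ 1).C_mul ζ)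

lemma X_sub_ne_zero (ζ : ℂ) : (X 0 - C ζ * X 1 : PolyS 2) ≠ 0 := by
  intro h
  simpa using congrArg (eval ![(1 : ℂ), 0]) h

lemma definingPoly_ne_zero (r m₁ m₂ n : ℕ) : definingPoly r m₁ m₂ n ≠ 0 :=
  mul_ne_zero (mul_ne_zero (pow_ne_zero _ (X_ne_zero 0)) (pow_ne_zero _ (X_ne_zero 1)))
    (Finset.prod_ne_zero_iff.mpr fun ζ _ => pow_ne_zero _ (X_sub_ne_zero ζ))

lemma isHomogeneous_definingPoly {r : ℕ} (hr : r ≠ 0) (m₁ m₂ n : ℕ) :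
    (definingPoly r m₁ m₂ n).IsHomogeneous (m₁ + m₂ + r * n) := by
  have hprod : (∏ ζ ∈ Polynomial.nthRootsFinset r (1 : ℂ),
      (X 0 - C ζ * X 1 : PolyS 2) ^ n).IsHomogeneous (r * n) := by
    have h := IsHomogeneous.prod (Polynomial.nthRootsFinset r (1 : ℂ))
      (fun ζ => (X 0 - C ζ * X 1 : PolyS 2) ^ n) (fun _ => 1 * n)
      fun ζ _ => (isHomogeneous_X_sub ζ).pow n
    simpa [(Complex.isPrimitiveRoot_exp r hr).card_nthRootsFinset] using h
  simpa [definingPoly] using (((isHomogeneous_X ℂ (0 : Fin 2)).pow m₁).mul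
    ((isHomogeneous_X ℂ 1).pow m₂)).mul hprod

lemma definingPoly_dvd {r m₁ m₂ n : ℕ} (hr : r ≠ 0) {p : PolyS 2} (h₁ : X 0 ^ m₁ ∣ p)
    (h₂ : X 1 ^ m₂ ∣ p) (h : ∀ ζ : ℂ, ζ ^ r = 1 → (X 0 - C ζ * X 1) ^ n ∣ p) :
    definingPoly r m₁ m₂ n ∣ p := by
  have hroot : ∀ ζ ∈ Polynomial.nthRootsFinset r (1 : ℂ), ζ ^ r = 1 := fun ζ hζ =>
    (Polynomial.mem_nthRootsFinset (Nat.pos_of_ne_zero hr) 1).mp hζ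
  have hX0 : ∀ ζ : ℂ, ζ ^ r = 1 → IsRelPrime (X 0 : PolyS 2) (X 0 - C ζ * X 1) := by
    intro ζ hζ
    have hne : (0 : ℂ) ≠ ζ := by
      rintro rfl
      simp [hr] at hζ
    simpa using isRelPrime_X_sub_C_mul_X hne
  refine IsRelPrime.mul_dvd ?_ (IsRelPrime.mul_dvd isRelPrime_X_zero_X_one.pow h₁ h₂)
    (Finset.prod_dvd_of_isRelPrime ?_ fun ζ hζ => h ζ (hroot ζ hζ))
  · exact IsRelPrime.prod_right fun ζ hζ => IsRelPrime.mul_left (hX0 ζ (hroot ζ hζ)).pow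
      (isRelPrime_X_one_sub ζ).pow
  · exact fun ζ _ ξ _ hne => (isRelPrime_X_sub_C_mul_X hne).pow

lemma inDeriv_iff {r m₁ m₂ n : ℕ} (θ : Derivation ℂ (PolyS 2) (PolyS 2)) :
    InDeriv r ![m₁, m₂] n θ ↔ X 0 ^ m₁ ∣ θ (X 0) ∧ X 1 ^ m₂ ∣ θ (X 1) ∧
      ∀ ζ : ℂ, ζ ^ r = 1 → (X 0 - C ζ * X 1) ^ n ∣ θ (X 0) - C ζ * θ (X 1) := by
  simp [InDeriv, Fin.forall_fin_two, Ideal.mem_span_singleton, and_assoc]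

/-- The coefficient determinant of two derivations of `ℂ[x, y]`. -/
def derivDet (θ η : Derivation ℂ (PolyS 2) (PolyS 2)) : PolyS 2 :=
  θ (X 0) * η (X 1) - θ (X 1) * η (X 0)

lemma definingPoly_dvd_derivDet {r m₁ m₂ n : ℕ} (hr : r ≠ 0)
    {θ η : Derivation ℂ (PolyS 2) (PolyS 2)} (hθ : InDeriv r ![m₁, m₂] n θ)
    (hη : InDeriv r ![m₁, m₂] n η) : definingPoly r m₁ m₂ n ∣ derivDet θ η := by
  obtain ⟨hθ₁, hθ₂, hθ⟩ := (inDeriv_iff θ).mp hθ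
  obtain ⟨hη₁, hη₂, hη⟩ := (inDeriv_iff η).mp hη
  refine definingPoly_dvd hr (dvd_sub (hθ₁.mul_right _) (hη₁.mul_left _))
    (dvd_sub (hη₂.mul_left _) (hθ₂.mul_right _)) fun ζ hζ => ?_
  convert dvd_sub ((hθ ζ hζ).mul_right (η (X 1))) ((hη ζ hζ).mul_left (θ (X 1))) using 1
  rw [derivDet]
  ring

/-- Saito's criterion in rank two: homogeneous elements of `D(A, μ)` with nonzero determinant whose
degrees add up to `|μ|` form a basis. -/
lemma isFreeWithExponents_of_derivDet_ne_zero {r m₁ m₂ n d₁ d₂ : ℕ} (hr : r ≠ 0)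
    {θ η : Derivation ℂ (PolyS 2) (PolyS 2)} (hθ : InDeriv r ![m₁, m₂] n θ)
    (hη : InDeriv r ![m₁, m₂] n η) (hθd : IsHomogDeriv θ d₁) (hηd : IsHomogDeriv η d₂)
    (hd : d₁ + d₂ = m₁ + m₂ + r * n) (hdet : derivDet θ η ≠ 0) :
    IsFreeWithExponents (InDeriv r ![m₁, m₂] n) ![d₁, d₂] := by
  obtain ⟨u, hu⟩ := definingPoly_dvd_derivDet hr hθ hη
  have hu₀ : u ≠ 0 := by
    rintro rfl
    exact hdet (by rw [hu, mul_zero])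
  have hhom : (derivDet θ η).IsHomogeneous (m₁ + m₂ + r * n) := by
    refine IsHomogeneous.sub ?_ ?_
    · exact hd ▸ (hθd 0).mul (hηd 1)
    · exact hd ▸ (hθd 1).mul (hηd 0)
  have hdeg : u.totalDegree = 0 := by
    have h := hhom.totalDegree hdet
    rw [hu, totalDegree_mul_of_isDomain (definingPoly_ne_zero _ _ _ _) hu₀,
      (isHomogeneous_definingPoly hr m₁ m₂ n).totalDegree (definingPoly_ne_zero _ _ _ _)] at h
    omega
  obtain ⟨c, rfl⟩ : ∃ c, u = C c := ⟨_, totalDegree_eq_zero_iff_eq_C.mp hdeg⟩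
  have hc : c ≠ 0 := by
    rintro rfl
    exact hu₀ C_0
  have hcinv : (C c * C c⁻¹ : PolyS 2) = 1 := by
    rw [← C_mul, mul_inv_cancel₀ hc, C_1]
  refine ⟨![θ, η], by simp [Fin.forall_fin_two, hθ, hη], ?_, fun δ hδ => ?_,
    by simp [Fin.forall_fin_two, hθd, hηd]⟩
  · rw [LinearIndependent.pair_iff]
    intro s t hst
    have h₀ : s * θ (X 0) + t * η (X 0) = 0 := by simpa using congrArg (fun δ => δ (X 0)) hst
    have h₁ : s * θ (X 1) + t * η (X 1) = 0 := by simpa using congrArg (fun δ => δ (X 1)) hst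
    constructor
    · refine (mul_eq_zero.mp (?_ : s * derivDet θ η = 0)).resolve_right hdet
      rw [derivDet]
      linear_combination η (X 1) * h₀ - η (X 0) * h₁
    · refine (mul_eq_zero.mp (?_ : t * derivDet θ η = 0)).resolve_right hdet
      rw [derivDet]
      linear_combination θ (X 0) * h₁ - θ (X 1) * h₀
  · obtain ⟨p, hp⟩ := definingPoly_dvd_derivDet hr hδ hη
    obtain ⟨q, hq⟩ := definingPoly_dvd_derivDet hr hθ hδ
    have key : ∀ i, δ (X i) = C c⁻¹ * p * θ (X i) + C c⁻¹ * q * η (X i) := by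
      intro i
      refine mul_left_cancel₀ hdet ?_
      have hcramer : derivDet θ η * δ (X i) =
          derivDet δ η * θ (X i) + derivDet θ δ * η (X i) := by
        fin_cases i <;> simp [derivDet] <;> ring
      rw [hcramer, hp, hq, hu]
      linear_combination
        -definingPoly r m₁ m₂ n * (p * θ (X i) + q * η (X i)) * hcinv
    have hδeq : δ = (C c⁻¹ * p) • θ + (C c⁻¹ * q) • η :=
      derivation_ext fun i => by simpa using key i
    rw [hδeq]
    exact add_mem (Submodule.smul_mem _ _ (Submodule.subset_span ⟨0, rfl⟩))
      (Submodule.smul_mem _ _ (Submodule.subset_span ⟨1, rfl⟩))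

theorem stmt8 (r m k : ℕ) (hr : 2 ≤ r) (hm : 1 ≤ m)
    (m1 m2 : ℕ)
    (h1low : ((k : ℤ) - 1) * r + 1 ≤ (m1 : ℤ)) (h1high : m1 ≤ k * r + 1)
    (h2low : ((k : ℤ) - 1) * r + 1 ≤ (m2 : ℤ)) (h2high : m2 ≤ k * r + 1) :
    IsFreeWithExponents (InDeriv r ![m1, m2] (2 * m))
      ![r * m + m1, r * m + m2] := by
  obtain ⟨n, rfl⟩ := Nat.exists_eq_add_of_le' hm
  have hr₀ : r ≠ 0 := by omega
  obtain ⟨s₁, hs₁⟩ : ∃ s, s + (k * r + 1) = m1 + r :=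
    ⟨m1 + r - (k * r + 1), Nat.sub_add_cancel (by zify; linarith)⟩
  obtain ⟨s₂, hs₂⟩ : ∃ s, s + (k * r + 1) = m2 + r :=
    ⟨m2 + r - (k * r + 1), Nat.sub_add_cancel (by zify; linarith)⟩
  obtain ⟨a, b, hb₀, hb, hdvd⟩ := exists_powForm_pair hr n k
  have twist : ∀ M s : ℕ, s + (k * r + 1) = M + r → ∀ ω : ℂ, ω ^ r = 1 → ∀ P Q : PolyS 2,
      (C ω * P - Q) ^ (2 * (n + 1)) ∣ C ω * (P ^ (k * r + 1) * Q ^ s * powForm r n a P Q)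
        - Q ^ M * powForm r (n + 1) b P Q := by
    intro M s hM ω hω P Q
    have hωk : ω ^ (k * r + 1) = ω := by
      rw [pow_succ, mul_comm k r, pow_mul, hω, one_pow, one_mul]
    have h := hdvd M s hM (C ω * P) Q
    rw [powForm_C_mul_left _ _ _ hω, powForm_C_mul_left _ _ _ hω, mul_pow, ← C_pow, hωk] at h
    convert h using 1
    ring
  have hX : ∀ i : Fin 2, (X i : PolyS 2).IsHomogeneous 1 := isHomogeneous_X ℂ
  have hF : ∀ {M s : ℕ}, s + (k * r + 1) = M + r → ∀ i j : Fin 2,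
      (X i ^ (k * r + 1) * X j ^ s * powForm r n a (X i) (X j) : PolyS 2).IsHomogeneous
        (r * (n + 1) + M) := by
    intro M s hM i j
    have h := (((hX i).pow (k * r + 1)).mul ((hX j).pow s)).mul
      (isHomogeneous_powForm r n a (hX i) (hX j))
    convert h using 1
    rw [mul_add]
    omega
  have hG : ∀ (M : ℕ) (i j : Fin 2),
      (X j ^ M * powForm r (n + 1) b (X i) (X j) : PolyS 2).IsHomogeneous (r * (n + 1) + M) := by
    intro M i j
    have h := ((hX j).pow M).mul (isHomogeneous_powForm r (n + 1) b (hX i) (hX j))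
    convert h using 1
    omega
  set θ : Derivation ℂ (PolyS 2) (PolyS 2) := mkDerivation ℂ
    ![X 0 ^ m1 * powForm r (n + 1) b (X 1) (X 0),
      X 1 ^ (k * r + 1) * X 0 ^ s₁ * powForm r n a (X 1) (X 0)] with hθ
  set η : Derivation ℂ (PolyS 2) (PolyS 2) := mkDerivation ℂ
    ![X 0 ^ (k * r + 1) * X 1 ^ s₂ * powForm r n a (X 0) (X 1),
      X 1 ^ m2 * powForm r (n + 1) b (X 0) (X 1)] with hη
  have hθ0 : θ (X 0) = X 0 ^ m1 * powForm r (n + 1) b (X 1) (X 0) := by simp [hθ]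
  have hθ1 : θ (X 1) = X 1 ^ (k * r + 1) * X 0 ^ s₁ * powForm r n a (X 1) (X 0) := by simp [hθ]
  have hη0 : η (X 0) = X 0 ^ (k * r + 1) * X 1 ^ s₂ * powForm r n a (X 0) (X 1) := by simp [hη]
  have hη1 : η (X 1) = X 1 ^ m2 * powForm r (n + 1) b (X 0) (X 1) := by simp [hη]
  refine isFreeWithExponents_of_derivDet_ne_zero (θ := θ) (η := η) hr₀ ?_ ?_ ?_ ?_ (by ring) ?_
  · rw [inDeriv_iff, hθ0, hθ1]
    refine ⟨dvd_mul_right _ _, ((pow_dvd_pow _ h2high).mul_right _).mul_right _, fun ζ hζ => ?_⟩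
    have h := twist m1 s₁ hs₁ ζ hζ (X 1) (X 0)
    rw [← neg_sub, (even_two_mul (n + 1)).neg_pow, ← dvd_neg, neg_sub] at h
    exact h
  · rw [inDeriv_iff, hη0, hη1]
    refine ⟨((pow_dvd_pow _ h1high).mul_right _).mul_right _, dvd_mul_right _ _, fun ζ hζ => ?_⟩
    have hζ₀ : ζ ≠ 0 := by
      rintro rfl
      simp [hr₀] at hζ
    have hinv : (C ζ * C ζ⁻¹ : PolyS 2) = 1 := by rw [← C_mul, mul_inv_cancel₀ hζ₀, C_1]
    have h := (twist m2 s₂ hs₂ ζ⁻¹ (by rw [inv_pow, hζ, inv_one]) (X 0) (X 1)).mul_left (C ζ)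
    have hlin : (X 0 - C ζ * X 1 : PolyS 2) ∣ C ζ⁻¹ * X 0 - X 1 :=
      ⟨C ζ⁻¹, by linear_combination X 1 * hinv⟩
    refine ((pow_dvd_pow_of_dvd hlin _).trans h).trans (dvd_of_eq ?_)
    linear_combination
      (X 0 ^ (k * r + 1) * X 1 ^ s₂ * powForm r n a (X 0) (X 1)) * hinv
  · simp only [IsHomogDeriv, Fin.forall_fin_two, hθ0, hθ1]
    exact ⟨hG m1 1 0, hF hs₁ 1 0⟩
  · simp only [IsHomogDeriv, Fin.forall_fin_two, hη0, hη1]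
    exact ⟨hF hs₂ 0 1, hG m2 0 1⟩
  · intro h
    have hfactor : (X 1 : PolyS 2) ^ m2 * (X 0 ^ m1 * powForm r (n + 1) b (X 1) (X 0) *
        powForm r (n + 1) b (X 0) (X 1) - X 1 ^ r * (X 0 ^ s₁ * powForm r n a (X 1) (X 0) *
          (X 0 ^ (k * r + 1) * powForm r n a (X 0) (X 1)))) = 0 := by
      rw [derivDet, hθ0, hθ1, hη0, hη1] at h
      have hpow : (X 1 : PolyS 2) ^ s₂ * X 1 ^ (k * r + 1) = X 1 ^ m2 * X 1 ^ r := by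
        rw [← pow_add, ← pow_add, hs₂]
      linear_combination h + (X 0 ^ s₁ * powForm r n a (X 1) (X 0) *
          (X 0 ^ (k * r + 1) * powForm r n a (X 0) (X 1))) * hpow
    have h₀ := congrArg (eval ![(1 : ℂ), 0])
      ((mul_eq_zero.mp hfactor).resolve_left (pow_ne_zero _ (X_ne_zero 1)))
    rw [map_sub, map_mul, map_mul, map_mul (eval ![(1 : ℂ), 0]) (X 1 ^ r),
      eval_powForm_zero_left hr₀ _ _ _ _ _ (by simp) (by simp),
      eval_powForm_zero_right hr₀ _ _ _ _ _ (by simp) (by simp)] at h₀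
    simp [hr₀, hb₀, hb] at h₀
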